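/- Let R be a Cohen–Macaulay commutative noetherian local ring of Krull dimension d, and let M and N be nonzero finitely generated R-modules with M totally reflexive. Fix a finite free presentation F₁ → F₀ → M → 0 and let T be its transpose (the cokernel of the induced map Hom_R(F₀,R) → Hom_R(F₁,R)). If Ext^j_R(T,N) = 0 for all 1 ≤ j ≤ d+1, then depth_R(M ⊗_R N) + depth R = depth_R(M) + depth_R(N). -/

import Mathlib

open CategoryTheory

universe u

/-- The `i`-th Ext module `Ext_R^i(M, N)` of `R`-modules `M` and `N`. -/
noncomputable def extModule (R : Type u) [CommRing R] (M N : Type u)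
    [AddCommGroup M] [Module R M] [AddCommGroup N] [Module R N] (i : ℕ) : ModuleCat.{u} R :=
  ((Ext R (ModuleCat.{u} R) i).obj (Opposite.op (ModuleCat.of R M))).obj (ModuleCat.of R N)

/-- The `i`-th Tor module `Tor^R_i(M, N)` of `R`-modules `M` and `N`. -/
noncomputable def torModule (R : Type u) [CommRing R] (M N : Type u)
    [AddCommGroup M] [Module R M] [AddCommGroup N] [Module R N] (i : ℕ) : ModuleCat.{u} R :=
  ((Tor (ModuleCat.{u} R) i).obj (ModuleCat.of R M)).obj (ModuleCat.of R N)

/-- The depth of a module `M` over a local ring `R`: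
`inf { i | Ext^i_R(k, M) ≠ 0 }` where `k` is the residue field, an element of `ℕ∞`
(the zero module has depth `⊤`, since the infimum of the empty set in `ℕ∞` is `⊤`). -/
noncomputable def moduleDepth (R : Type u) [CommRing R] [IsLocalRing R] (M : Type u)
    [AddCommGroup M] [Module R M] : ℕ∞ :=
  sInf {i : ℕ∞ | ∃ n : ℕ, i = (n : ℕ∞) ∧
    Nontrivial (extModule R (IsLocalRing.ResidueField R) M n)}

/-- A module `M` is totally reflexive if the canonical evaluation map `M → M**` is bijective
and `Ext^i_R(M, R) = 0 = Ext^i_R(M*, R)` for all `i > 0`. -/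
def IsTotallyReflexive (R : Type u) [CommRing R] (M : Type u)
    [AddCommGroup M] [Module R M] : Prop :=
  Function.Bijective (Module.Dual.eval R M) ∧
    (∀ i : ℕ, 0 < i → Subsingleton (extModule R M R i)) ∧
    (∀ i : ℕ, 0 < i → Subsingleton (extModule R (Module.Dual R M) R i))

/-- A module `P` has finite projective dimension iff for some `n`, `Ext^i_R(P, -)` vanishes
for all `i > n`. -/
def HasFiniteProjectiveDimension (R : Type u) [CommRing R] (P : Type u)
    [AddCommGroup P] [Module R P] : Prop :=
  ∃ n : ℕ, ∀ (N : Type u) [AddCommGroup N] [Module R N] (i : ℕ), n < i →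
    Subsingleton (extModule R P N i)

/-- A module `Q` has finite injective dimension iff for some `n`, `Ext^i_R(-, Q)` vanishes
for all `i > n`. -/
def HasFiniteInjectiveDimension (R : Type u) [CommRing R] (Q : Type u)
    [AddCommGroup Q] [Module R Q] : Prop :=
  ∃ n : ℕ, ∀ (N : Type u) [AddCommGroup N] [Module R N] (i : ℕ), n < i →
    Subsingleton (extModule R N Q i)

theorem subsingleton_extModule_iff (R : Type u) [CommRing R] (M N : Type u)
    [AddCommGroup M] [Module R M] [AddCommGroup N] [Module R N] (n : ℕ) :
    Subsingleton (extModule R M N n) ↔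
      Subsingleton (Abelian.Ext (ModuleCat.of R M) (ModuleCat.of R N) n) := by
  let P := projectiveResolution (ModuleCat.of R M)
  have e := (P.isoExt (R := R) n (ModuleCat.of R N)).toLinearEquiv.toEquiv
  unfold extModule
  rw [e.subsingleton_congr, ← ModuleCat.isZero_iff_subsingleton,
    ← HomologicalComplex.exactAt_iff_isZero_homology]
  cases n with
  | zero =>
    let π : P.complex.X 0 ⟶ ModuleCat.of R M := P.π.f 0
    have : Epi π := inferInstanceAs (Epi (P.π.f 0))
    have hπ : P.complex.d 1 0 ≫ π = 0 := P.complex_d_comp_π_f_zero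
    rw [Abelian.Ext.addEquiv₀.subsingleton_congr]
    rw [HomologicalComplex.exactAt_iff' _ 0 0 1 (by simp) (by simp),
      ShortComplex.moduleCat_exact_iff]
    constructor
    · intro h
      refine subsingleton_of_forall_eq 0 fun f => ?_
      obtain ⟨y, hy⟩ := h (π ≫ f) (by
        change P.complex.d 1 0 ≫ π ≫ f = 0
        rw [reassoc_of% hπ, Limits.zero_comp])
      have h0 : (P.complex.linearYonedaObj R (ModuleCat.of R N)).d 0 0 = 0 :=
        HomologicalComplex.shape _ _ _ (by simp)
      have hz : π ≫ f = 0 := by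
        rw [← hy]
        change (P.complex.linearYonedaObj R (ModuleCat.of R N)).d 0 0 y = 0
        rw [h0]
        rfl
      exact (cancel_epi π).1 (hz.trans Limits.comp_zero.symm)
    · intro h f hf
      obtain ⟨l, hl⟩ := Limits.CokernelCofork.IsColimit.desc' P.isColimitCokernelCofork
        (show P.complex.X 0 ⟶ ModuleCat.of R N from f) hf
      have hl' : π ≫ l = f := hl
      refine ⟨0, (map_zero _).trans ?_⟩
      rw [← hl', Subsingleton.elim (α := ModuleCat.of R M ⟶ ModuleCat.of R N) l 0,
        Limits.comp_zero]
      rfl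
  | succ p =>
    rw [HomologicalComplex.exactAt_iff' _ p (p + 1) (p + 2) (by simp) (by simp),
      ShortComplex.moduleCat_exact_iff]
    constructor
    · intro h
      refine subsingleton_of_forall_eq 0 fun α => ?_
      obtain ⟨f, hf, rfl⟩ := P.extMk_surjective α (p + 2) rfl
      rw [P.extMk_eq_zero_iff _ _ _ _ p rfl]
      exact h f hf
    · intro h f hf
      exact (P.extMk_eq_zero_iff f (p + 2) rfl hf p rfl).1 (Subsingleton.elim _ _)

section ExtVanishing

variable {R : Type u} [CommRing R] {K A B C N : Type u}
  [AddCommGroup K] [Module R K] [AddCommGroup A] [Module R A] [AddCommGroup B] [Module R B]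
  [AddCommGroup C] [Module R C] [AddCommGroup N] [Module R N]

/-- `Ext^i(K, Y) = 0` for all `i < t`. -/
def ExtVanishesBelow (R : Type u) [CommRing R] (K : Type u) [AddCommGroup K] [Module R K]
    (Y : Type u) [AddCommGroup Y] [Module R Y] (t : ℕ) : Prop :=
  ∀ i < t, Subsingleton (Abelian.Ext (ModuleCat.of R K) (ModuleCat.of R Y) i)

theorem ExtVanishesBelow.mono {s t : ℕ} (h : ExtVanishesBelow R K N t) (hst : s ≤ t) :
    ExtVanishesBelow R K N s :=
  fun i hi => h i (hi.trans_le hst)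

theorem shortExact_of_linearMap {f : A →ₗ[R] B} {g : B →ₗ[R] C} (hf : Function.Injective f)
    (hfg : Function.Exact f g) (hg : Function.Surjective g) :
    (ShortComplex.mk (ModuleCat.ofHom f) (ModuleCat.ofHom g)
      (by ext x; exact hfg.apply_apply_eq_zero x)).ShortExact where
  exact := (ShortComplex.ShortExact.moduleCat_exact_iff_function_exact _).mpr hfg
  mono_f := (ModuleCat.mono_iff_injective _).mpr hf
  epi_g := (ModuleCat.epi_iff_surjective _).mpr hg

/-- If `A → B → C` is short exact and `Ext^i(K, C) = 0` for `i < t`, then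
`Ext^t(K, A) → Ext^t(K, B)` is injective. -/
theorem ext_comp_injective {t : ℕ} {f : A →ₗ[R] B} {g : B →ₗ[R] C}
    (hf : Function.Injective f) (hfg : Function.Exact f g) (hg : Function.Surjective g)
    (hC : ExtVanishesBelow R K C t) (x : Abelian.Ext (ModuleCat.of R K) (ModuleCat.of R A) t)
    (hx : x.comp (Abelian.Ext.mk₀ (ModuleCat.ofHom f)) (add_zero t) = 0) : x = 0 := by
  have hS := shortExact_of_linearMap hf hfg hg
  cases t with
  | zero =>
    have := hS.mono_f
    exact Abelian.Ext.postcomp_mk₀_injective_of_mono _ (ModuleCat.ofHom f)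
      (hx.trans (map_zero _).symm)
  | succ j =>
    have := hC j (by lia)
    obtain ⟨y, rfl⟩ := Abelian.Ext.covariant_sequence_exact₁ _ hS x hx rfl
    rw [Subsingleton.elim (α := Abelian.Ext (ModuleCat.of R K) (ModuleCat.of R C) j) y 0]
    exact Abelian.Ext.zero_comp ..

/-- Ext vanishing passes to kernels of surjections, with a shift by one. -/
theorem ExtVanishesBelow.of_exact {t : ℕ} {f : A →ₗ[R] B} {g : B →ₗ[R] C}
    (hf : Function.Injective f) (hfg : Function.Exact f g) (hg : Function.Surjective g)
    (hB : ExtVanishesBelow R K B (t + 1)) (hC : ExtVanishesBelow R K C t) :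
    ExtVanishesBelow R K A (t + 1) := by
  intro i hi
  refine subsingleton_of_forall_eq 0 fun x => ?_
  have := hB i hi
  exact ext_comp_injective hf hfg hg (hC.mono (by lia)) x (Subsingleton.elim _ _)

theorem subsingleton_ext_of_retract {i : ℕ} (f : A →ₗ[R] B) (g : B →ₗ[R] A)
    (h : g ∘ₗ f = LinearMap.id)
    [Subsingleton (Abelian.Ext (ModuleCat.of R K) (ModuleCat.of R B) i)] :
    Subsingleton (Abelian.Ext (ModuleCat.of R K) (ModuleCat.of R A) i) := by
  refine subsingleton_of_forall_eq 0 fun x => ?_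
  have h' : ModuleCat.ofHom f ≫ ModuleCat.ofHom g = 𝟙 _ := by
    rw [← ModuleCat.ofHom_comp, h]
    rfl
  rw [← x.comp_mk₀_id, ← h', ← Abelian.Ext.mk₀_comp_mk₀,
    ← Abelian.Ext.comp_assoc_of_third_deg_zero,
    Subsingleton.elim (x.comp (Abelian.Ext.mk₀ (ModuleCat.ofHom f)) (add_zero i)) 0,
    Abelian.Ext.zero_comp]

theorem ExtVanishesBelow.congr {t : ℕ} (e : A ≃ₗ[R] B) (h : ExtVanishesBelow R K B t) :
    ExtVanishesBelow R K A t := fun i hi =>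
  have := h i hi
  subsingleton_ext_of_retract e.toLinearMap e.symm.toLinearMap (by ext; simp)

variable {P : Type u} [AddCommGroup P] [Module R P] [Module.Free R P]

theorem subsingleton_ext_linearMap [Module.Finite R P] {i : ℕ}
    [Subsingleton (Abelian.Ext (ModuleCat.of R K) (ModuleCat.of R N) i)] :
    Subsingleton (Abelian.Ext (ModuleCat.of R K) (ModuleCat.of R (P →ₗ[R] N)) i) := by
  let b := Module.Free.chooseBasis R P
  refine subsingleton_of_forall_eq 0 fun x => ?_
  let f (j) : ModuleCat.of R (P →ₗ[R] N) ⟶ ModuleCat.of R N :=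
    ModuleCat.ofHom (LinearMap.applyₗ (b j))
  let g (j) : ModuleCat.of R N ⟶ ModuleCat.of R (P →ₗ[R] N) :=
    ModuleCat.ofHom ((LinearMap.smulRightₗ (R := R) (M₂ := P) (M := N)) (b.coord j))
  have h : 𝟙 (ModuleCat.of R (P →ₗ[R] N)) = ∑ j, f j ≫ g j := by
    refine ModuleCat.hom_ext (LinearMap.ext fun φ => ?_)
    refine b.ext fun l => ?_
    simp [f, g, ModuleCat.hom_sum, LinearMap.sum_apply, Finsupp.single_apply]
  rw [← x.comp_mk₀_id, h, Abelian.Ext.mk₀_sum, Abelian.Ext.comp_sum]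
  refine Finset.sum_eq_zero fun j _ => ?_
  rw [← Abelian.Ext.mk₀_comp_mk₀, ← Abelian.Ext.comp_assoc_of_third_deg_zero,
    Subsingleton.elim (x.comp (Abelian.Ext.mk₀ (f j)) (add_zero i)) 0,
    Abelian.Ext.zero_comp]

theorem ExtVanishesBelow.linearMap [Module.Finite R P] {t : ℕ} (h : ExtVanishesBelow R K N t) :
    ExtVanishesBelow R K (P →ₗ[R] N) t := fun i hi =>
  have := h i hi
  subsingleton_ext_linearMap

theorem subsingleton_ext_of_linearMap [Nontrivial R] [Nontrivial P] {i : ℕ}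
    [Subsingleton (Abelian.Ext (ModuleCat.of R K) (ModuleCat.of R (P →ₗ[R] N)) i)] :
    Subsingleton (Abelian.Ext (ModuleCat.of R K) (ModuleCat.of R N) i) := by
  let b := Module.Free.chooseBasis R P
  obtain ⟨j⟩ := b.index_nonempty
  refine subsingleton_ext_of_retract
    ((LinearMap.smulRightₗ (R := R) (M₂ := P) (M := N)) (b.coord j))
    (LinearMap.applyₗ (b j)) ?_
  ext
  simp

/-- Dimension shifting along a presentation by a projective module. -/
theorem subsingleton_ext_ker {i : ℕ} {f : P →ₗ[R] B} (hf : Function.Surjective f)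
    (hi : 1 ≤ i) [Subsingleton (Abelian.Ext (ModuleCat.of R B) (ModuleCat.of R N) (i + 1))] :
    Subsingleton (Abelian.Ext (ModuleCat.of R (LinearMap.ker f)) (ModuleCat.of R N) i) := by
  have hS := LinearMap.shortExact_shortComplexKer hf
  refine subsingleton_of_forall_eq 0 fun x => ?_
  have : Projective (ModuleCat.of R P) :=
    (IsProjective.iff_projective (R := R) (P := P)).1 inferInstance
  obtain ⟨y, rfl⟩ := Abelian.Ext.contravariant_sequence_exact₁ hS _ x (add_comm 1 i)
    (Subsingleton.elim (α := Abelian.Ext (ModuleCat.of R B) (ModuleCat.of R N) (i + 1)) _ _)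
  obtain ⟨j, rfl⟩ := Nat.exists_eq_add_of_le' hi
  rw [Abelian.Ext.eq_zero_of_projective (P := ModuleCat.of R P) y]
  exact Abelian.Ext.comp_zero ..

theorem exists_extension_of_subsingleton_ext {f : A →ₗ[R] B} (hf : Function.Surjective f)
    [Subsingleton (Abelian.Ext (ModuleCat.of R B) (ModuleCat.of R N) 1)]
    (φ : LinearMap.ker f →ₗ[R] N) : ∃ ψ : A →ₗ[R] N, ψ ∘ₗ (LinearMap.ker f).subtype = φ := by
  have hS := LinearMap.shortExact_shortComplexKer hf
  obtain ⟨y, hy⟩ := Abelian.Ext.contravariant_sequence_exact₁ hS (ModuleCat.of R N)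
    (Abelian.Ext.mk₀ (ModuleCat.ofHom φ)) (add_comm 1 0)
    (Subsingleton.elim (α := Abelian.Ext (ModuleCat.of R B) (ModuleCat.of R N) 1) _ _)
  obtain ⟨ψ, rfl⟩ := Abelian.Ext.addEquiv₀.symm.surjective y
  refine ⟨ψ.hom, ?_⟩
  have h := (Abelian.Ext.mk₀_comp_mk₀ _ _).symm.trans hy
  exact congrArg ModuleCat.Hom.hom ((Abelian.Ext.mk₀_bijective _ _).1 h)

/-- A linear map with coefficients in the annihilator of `K` induces zero on `Ext(K, -)`. -/
theorem ext_comp_eq_zero_of_mem_smul_top {α : A →ₗ[R] B}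
    (hα : α ∈ Module.annihilator R K • (⊤ : Submodule R (A →ₗ[R] B))) {i : ℕ}
    (x : Abelian.Ext (ModuleCat.of R K) (ModuleCat.of R A) i) :
    x.comp (Abelian.Ext.mk₀ (ModuleCat.ofHom α)) (add_zero i) = 0 := by
  induction hα using Submodule.smul_induction_on' with
  | smul r hr β _ =>
    have h0 : r • 𝟙 (ModuleCat.of R K) = 0 := by
      ext y
      exact Module.mem_annihilator.1 hr y
    have hx : r • x = 0 := by
      rw [← x.mk₀_id_comp, ← Abelian.Ext.smul_comp, ← Abelian.Ext.mk₀_smul, h0,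
        Abelian.Ext.mk₀_zero, Abelian.Ext.zero_comp]
    rw [show ModuleCat.ofHom (r • β) = r • ModuleCat.ofHom β from rfl,
      Abelian.Ext.mk₀_smul, Abelian.Ext.comp_smul, ← Abelian.Ext.smul_comp, hx,
      Abelian.Ext.zero_comp]
  | add β _ γ _ h₁ h₂ =>
    rw [show ModuleCat.ofHom (β + γ) = ModuleCat.ofHom β + ModuleCat.ofHom γ from rfl,
      Abelian.Ext.mk₀_add, Abelian.Ext.comp_add, h₁, h₂, add_zero]

end ExtVanishing

section Minimal

open IsLocalRing TensorProduct

variable (R : Type u) [CommRing R] [IsLocalRing R]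

theorem maximalIdeal_le_annihilator_residueField :
    maximalIdeal R ≤ Module.annihilator R (ResidueField R) := by
  intro x hx
  rw [Module.mem_annihilator]
  intro y
  rw [Algebra.smul_def, ResidueField.algebraMap_eq, (residue_eq_zero_iff x).2 hx, zero_mul]

/-- A finitely generated module over a local ring has a free cover with kernel in `𝔪 • Rⁿ`. -/
theorem exists_minimal_free_cover (M : Type u) [AddCommGroup M] [Module R M] [Module.Finite R M] :
    ∃ (n : ℕ) (f : (Fin n → R) →ₗ[R] M), Function.Surjective f ∧
      ∀ x, f x = 0 → ∀ i, x i ∈ maximalIdeal R := by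
  let b := Module.finBasis (ResidueField R) (ResidueField R ⊗[R] M)
  obtain ⟨v, hv⟩ := (TensorProduct.mk_surjective R M (ResidueField R)
    Ideal.Quotient.mk_surjective).comp_left b
  refine ⟨_, Fintype.linearCombination R v, ?_, fun x hx i => ?_⟩
  · rw [← LinearMap.range_eq_top, Fintype.range_linearCombination]
    exact span_eq_top_of_tmul_eq_basis v b (congrFun hv)
  · have h : ∑ j, residue R (x j) • b j = 0 := by
      have := congrArg (TensorProduct.mk R (ResidueField R) M 1) hx
      rw [Fintype.linearCombination_apply, map_sum, map_zero] at this
      rw [← this]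
      refine Finset.sum_congr rfl fun j _ => ?_
      rw [map_smul, ← hv]
      exact (algebraMap_smul (ResidueField R) (x j) _)
    exact (residue_eq_zero_iff _).1 (Fintype.linearIndependent_iff.1 b.linearIndependent _ h i)

theorem lcomp_mem_smul_top {S : Type u} [CommRing S] (I : Ideal S) (N : Type u) [AddCommGroup N]
    [Module S N] {m n : ℕ} (ψ : (Fin m → S) →ₗ[S] (Fin n → S)) (hψ : ∀ x i, ψ x i ∈ I) :
    LinearMap.lcomp S N ψ ∈
      I • (⊤ : Submodule S (((Fin n → S) →ₗ[S] N) →ₗ[S] ((Fin m → S) →ₗ[S] N))) := by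
  have : LinearMap.lcomp S N ψ = ∑ i, ∑ j, ψ (Pi.single i 1) j •
      LinearMap.lcomp S N ((LinearMap.proj i).smulRight (Pi.single j 1)) := by
    ext h i
    simp only [LinearMap.comp_apply, LinearMap.lcomp_apply, LinearMap.sum_apply,
      LinearMap.smul_apply, LinearMap.smulRight_apply, LinearMap.proj_apply,
      LinearMap.single_apply, map_smul]
    rw [Finset.sum_eq_single i (fun j _ hj => by simp [hj]) (by simp)]
    conv_lhs => rw [← Finset.univ_sum_single (ψ (Pi.single i 1)), map_sum]
    refine Finset.sum_congr rfl fun j _ => ?_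
    rw [Pi.single_eq_same, one_smul, ← map_smul, ← Pi.single_smul, smul_eq_mul, mul_one]
  rw [this]
  exact Submodule.sum_mem _ fun i _ => Submodule.sum_mem _ fun j _ =>
    Submodule.smul_mem_smul (hψ _ _) trivial

end Minimal

section Presentation

variable {R : Type u} [CommRing R] {K N T P P' P'' D : Type u}
  [AddCommGroup K] [Module R K] [AddCommGroup N] [Module R N] [AddCommGroup T] [Module R T]
  [AddCommGroup P] [Module R P] [AddCommGroup P'] [Module R P'] [AddCommGroup P''] [Module R P'']
  [AddCommGroup D] [Module R D]

/-- The surjection from `P'` onto the kernel of `P → T` given by a presentation `P' → P → T`. -/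
def kernelCover (φ : P' →ₗ[R] P) (p : P →ₗ[R] T) (hφp : Function.Exact φ p) :
    P' →ₗ[R] LinearMap.ker p :=
  φ.codRestrict (LinearMap.ker p) fun x => hφp.apply_apply_eq_zero x

variable {φ : P' →ₗ[R] P} {p : P →ₗ[R] T} {ψ : P'' →ₗ[R] P'} {q : (P' →ₗ[R] N) →ₗ[R] D}

theorem kernelCover_surjective (hφp : Function.Exact φ p) :
    Function.Surjective (kernelCover φ p hφp) := by
  rintro ⟨x, hx⟩
  obtain ⟨y, rfl⟩ := (hφp x).1 hx
  exact ⟨y, rfl⟩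

theorem exact_kernelCover_iff (hφp : Function.Exact φ p) :
    Function.Exact ψ (kernelCover φ p hφp) ↔ Function.Exact ψ φ :=
  forall_congr' fun x => by
    rw [← Subtype.val_inj]
    rfl

/-- If `Ext¹(T, N) = 0` and `P'' → P' → P → T → 0` is exact, then the cokernel `D` of
`Hom(P, N) → Hom(P', N)` embeds into `Hom(P'', N)`. -/
theorem exists_embedding_of_subsingleton_ext (hφp : Function.Exact φ p)
    (hp : Function.Surjective p) (hψφ : Function.Exact ψ φ)
    (hq : Function.Exact (LinearMap.lcomp R N φ) q) (hqs : Function.Surjective q)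
    [Subsingleton (Abelian.Ext (ModuleCat.of R T) (ModuleCat.of R N) 1)] :
    ∃ ι : D →ₗ[R] (P'' →ₗ[R] N), Function.Injective ι ∧ ι ∘ₗ q = LinearMap.lcomp R N ψ := by
  have hker : LinearMap.ker q = LinearMap.ker (LinearMap.lcomp R N ψ) := by
    ext h
    rw [LinearMap.mem_ker, LinearMap.mem_ker, hq h]
    constructor
    · rintro ⟨χ, rfl⟩
      ext x
      simp [hψφ.apply_apply_eq_zero]
    · intro hh
      have hle : LinearMap.ker (kernelCover φ p hφp) ≤ LinearMap.ker h := by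
        intro x hx
        obtain ⟨y, rfl⟩ := ((exact_kernelCover_iff hφp).2 hψφ x).1 hx
        exact LinearMap.congr_fun hh y
      let e := (kernelCover φ p hφp).quotKerEquivOfSurjective (kernelCover_surjective hφp)
      obtain ⟨χ, hχ⟩ := exists_extension_of_subsingleton_ext hp
        ((LinearMap.ker (kernelCover φ p hφp)).liftQ h hle ∘ₗ e.symm.toLinearMap)
      refine ⟨χ, LinearMap.ext fun x => ?_⟩
      have h₁ := LinearMap.congr_fun hχ (kernelCover φ p hφp x)
      have h₂ : e.symm (kernelCover φ p hφp x) = Submodule.Quotient.mk x := by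
        rw [LinearEquiv.symm_apply_eq]
        rfl
      refine h₁.trans ?_
      simp [h₂]
  let e := q.quotKerEquivOfSurjective hqs
  refine ⟨(LinearMap.ker q).liftQ (LinearMap.lcomp R N ψ) hker.le ∘ₗ e.symm.toLinearMap,
    ?_, ?_⟩
  · rw [LinearMap.coe_comp]
    refine Function.Injective.comp ?_ e.symm.injective
    rw [← LinearMap.ker_eq_bot, Submodule.ker_liftQ_eq_bot _ _ _ hker.ge]
  · ext1 h
    have h₂ : e.symm (q h) = Submodule.Quotient.mk h := by
      rw [LinearEquiv.symm_apply_eq]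
      rfl
    simp [h₂]

theorem exact_mkQ_of_comp_eq {ι : D →ₗ[R] (P'' →ₗ[R] N)} (hqs : Function.Surjective q)
    (hι : ι ∘ₗ q = LinearMap.lcomp R N ψ) :
    Function.Exact ι (LinearMap.range (LinearMap.lcomp R N ψ)).mkQ := by
  rw [LinearMap.exact_iff, Submodule.ker_mkQ, ← hι,
    LinearMap.range_comp_of_range_eq_top _ (LinearMap.range_eq_top.2 hqs)]

theorem exact_lcomp_mkQ (N : Type u) [AddCommGroup N] [Module R N] (ψ : P'' →ₗ[R] P') :
    Function.Exact (LinearMap.lcomp R N ψ) (LinearMap.range (LinearMap.lcomp R N ψ)).mkQ := by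
  rw [LinearMap.exact_iff, Submodule.ker_mkQ]

theorem exists_free_cover_ker [IsNoetherianRing R] [Module.Finite R P'] (φ : P' →ₗ[R] P) :
    ∃ (n : ℕ) (ψ : (Fin n → R) →ₗ[R] P'), Function.Exact ψ φ := by
  obtain ⟨n, f, hf⟩ := Module.Finite.exists_fin' R (LinearMap.ker φ)
  refine ⟨n, (LinearMap.ker φ).subtype ∘ₗ f, ?_⟩
  rw [LinearMap.exact_iff, LinearMap.range_comp_of_range_eq_top _ (LinearMap.range_eq_top.2 hf),
    Submodule.range_subtype]

/-- If `Ext^i(T, N) = 0` for `1 ≤ i ≤ t` and `Ext^i(K, N) = 0` for `i < t`, then also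
`Ext^i(K, D) = 0` for `i < t`, where `D` is the cokernel of `Hom(P, N) → Hom(P', N)` for a free
presentation `P' → P → T → 0`. -/
theorem ExtVanishesBelow.of_presentation [IsNoetherianRing R]
    [Module.Free R P] [Module.Free R P'] [Module.Finite R P'] {t : ℕ}
    (hφp : Function.Exact φ p) (hp : Function.Surjective p)
    (hq : Function.Exact (LinearMap.lcomp R N φ) q) (hqs : Function.Surjective q)
    (hT : ∀ i, 1 ≤ i → i ≤ t →
      Subsingleton (Abelian.Ext (ModuleCat.of R T) (ModuleCat.of R N) i))
    (hN : ExtVanishesBelow R K N t) : ExtVanishesBelow R K D t := by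
  induction t generalizing T P P' D with
  | zero => exact fun i hi => absurd hi (Nat.not_lt_zero i)
  | succ t ih =>
    obtain ⟨n, ψ, hψφ⟩ := exists_free_cover_ker φ
    have := hT 1 le_rfl (by lia)
    obtain ⟨ι, hι, hιq⟩ := exists_embedding_of_subsingleton_ext hφp hp hψφ hq hqs
    refine .of_exact hι (exact_mkQ_of_comp_eq hqs hιq) (Submodule.mkQ_surjective _) hN.linearMap ?_
    refine ih ((exact_kernelCover_iff hφp).2 hψφ) (kernelCover_surjective hφp)
      (exact_lcomp_mkQ N ψ) (Submodule.mkQ_surjective _) (fun i hi hit => ?_)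
      (hN.mono (Nat.le_succ t))
    have := hT (i + 1) (by lia) (by lia)
    exact subsingleton_ext_ker hp hi

open IsLocalRing in
theorem subsingleton_ext_of_presentation [IsNoetherianRing R] [IsLocalRing R]
    [Module.Free R P] [Module.Free R P'] [Module.Finite R P'] {t : ℕ}
    (hφp : Function.Exact φ p) (hp : Function.Surjective p) (hφ : ¬ Function.Injective φ)
    (hq : Function.Exact (LinearMap.lcomp R N φ) q) (hqs : Function.Surjective q)
    (hT : ∀ i, 1 ≤ i → i ≤ t + 2 →
      Subsingleton (Abelian.Ext (ModuleCat.of R T) (ModuleCat.of R N) i))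
    (hN : ExtVanishesBelow R (ResidueField R) N t)
    [Subsingleton (Abelian.Ext (ModuleCat.of R (ResidueField R)) (ModuleCat.of R D) t)] :
    Subsingleton (Abelian.Ext (ModuleCat.of R (ResidueField R)) (ModuleCat.of R N) t) := by
  obtain ⟨n, c, hc, hcm⟩ := exists_minimal_free_cover R (LinearMap.ker φ)
  let ψ := (LinearMap.ker φ).subtype ∘ₗ c
  have hψφ : Function.Exact ψ φ := by
    rw [LinearMap.exact_iff, LinearMap.range_comp_of_range_eq_top _ (LinearMap.range_eq_top.2 hc),
      Submodule.range_subtype]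
  have hψ (x) (hx : ψ x = 0) (i) : x i ∈ maximalIdeal R := hcm x (Subtype.ext hx) i
  obtain ⟨m, ψ', hψ'ψ⟩ := exists_free_cover_ker ψ
  have hT' : ∀ i, 1 ≤ i → i ≤ t + 1 →
      Subsingleton (Abelian.Ext (ModuleCat.of R (LinearMap.ker p)) (ModuleCat.of R N) i) := by
    intro i hi hit
    have := hT (i + 1) (by lia) (by lia)
    exact subsingleton_ext_ker hp hi
  have hn : Nontrivial (Fin n → R) := by
    by_contra hn
    rw [not_nontrivial_iff_subsingleton] at hn
    refine hφ ((injective_iff_map_eq_zero _).2 fun x hx => ?_)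
    obtain ⟨y, rfl⟩ := (hψφ x).1 hx
    rw [Subsingleton.elim y 0, map_zero]
  have := hT 1 le_rfl (by lia)
  obtain ⟨ι, hι, hιq⟩ := exists_embedding_of_subsingleton_ext hφp hp hψφ hq hqs
  have hpre := (exact_kernelCover_iff hφp).2 hψφ
  have hpre_surj := kernelCover_surjective hφp
  have := hT' 1 le_rfl (by lia)
  obtain ⟨ι', hι', hι'q⟩ := exists_embedding_of_subsingleton_ext hpre hpre_surj hψ'ψ
    (exact_lcomp_mkQ N ψ) (Submodule.mkQ_surjective _)
  have hD'' : ExtVanishesBelow R (ResidueField R) (_ ⧸ LinearMap.range (LinearMap.lcomp R N ψ'))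
      t := by
    refine .of_presentation ((exact_kernelCover_iff hpre).2 hψ'ψ) (kernelCover_surjective hpre)
      (exact_lcomp_mkQ N ψ') (Submodule.mkQ_surjective _) (fun i hi hit => ?_) hN
    have := hT' (i + 1) (by lia) (by lia)
    exact subsingleton_ext_ker hpre_surj hi
  suffices Subsingleton (Abelian.Ext (ModuleCat.of R (ResidueField R))
      (ModuleCat.of R ((Fin n → R) →ₗ[R] N)) t) from
    subsingleton_ext_of_linearMap (P := Fin n → R)
  refine subsingleton_of_forall_eq 0 fun x => ?_
  have hS := shortExact_of_linearMap hι (exact_mkQ_of_comp_eq hqs hιq) (Submodule.mkQ_surjective _)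
  have hx : x.comp (Abelian.Ext.mk₀ (ModuleCat.ofHom
      (LinearMap.range (LinearMap.lcomp R N ψ)).mkQ)) (add_zero t) = 0 := by
    refine ext_comp_injective hι' (exact_mkQ_of_comp_eq (Submodule.mkQ_surjective _) hι'q)
      (Submodule.mkQ_surjective _) hD'' _ ?_
    rw [Abelian.Ext.comp_assoc_of_third_deg_zero, Abelian.Ext.mk₀_comp_mk₀, ← ModuleCat.ofHom_comp,
      hι'q]
    refine ext_comp_eq_zero_of_mem_smul_top (Submodule.smul_mono_left
      (maximalIdeal_le_annihilator_residueField R) (lcomp_mem_smul_top _ N ψ' fun y i => ?_)) x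
    exact hψ _ (hψ'ψ.apply_apply_eq_zero y) i
  obtain ⟨y, rfl⟩ := Abelian.Ext.covariant_sequence_exact₂ _ hS x hx
  rw [Subsingleton.elim (α := Abelian.Ext (ModuleCat.of R (ResidueField R))
    (ModuleCat.of R D) t) y 0]
  exact Abelian.Ext.zero_comp ..

end Presentation

section TensorPresentation

open TensorProduct

variable {R : Type u} [CommRing R] {M F₀ F₁ : Type u} [AddCommGroup M] [Module R M]
  [AddCommGroup F₀] [Module R F₀] [Module.Free R F₀] [Module.Finite R F₀]
  [AddCommGroup F₁] [Module R F₁] [Module.Free R F₁] [Module.Finite R F₁]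

/-- The isomorphism `F ⊗ N ≃ Hom(F*, N)` for a finite free module `F`. -/
noncomputable def tensorEquivHomDual (R : Type u) [CommRing R] (F N : Type u)
    [AddCommGroup F] [Module R F] [Module.Free R F] [Module.Finite R F]
    [AddCommGroup N] [Module R N] : F ⊗[R] N ≃ₗ[R] (Module.Dual R F →ₗ[R] N) :=
  (Module.evalEquiv R F).rTensor N ≪≫ₗ dualTensorHomEquiv R (Module.Dual R F) N

theorem tensorEquivHomDual_comp_rTensor (f : F₁ →ₗ[R] F₀) (N : Type u) [AddCommGroup N]
    [Module R N] :
    LinearMap.lcomp R N f.dualMap ∘ₗ (tensorEquivHomDual R F₁ N).toLinearMap =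
      (tensorEquivHomDual R F₀ N).toLinearMap ∘ₗ f.rTensor N := by
  ext x n ξ
  rfl

/-- The transpose presents `M ⊗ N` as the cokernel of `Hom(F₁*, N) → Hom(F₀*, N)`. -/
theorem exists_tensor_presentation {f : F₁ →ₗ[R] F₀} {g : F₀ →ₗ[R] M}
    (hg : Function.Surjective g) (hfg : Function.Exact f g) (N : Type u) [AddCommGroup N]
    [Module R N] :
    ∃ q : (Module.Dual R F₀ →ₗ[R] N) →ₗ[R] M ⊗[R] N,
      Function.Exact (LinearMap.lcomp R N f.dualMap) q ∧ Function.Surjective q := by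
  refine ⟨g.rTensor N ∘ₗ (tensorEquivHomDual R F₀ N).symm.toLinearMap, ?_, ?_⟩
  · refine Function.Exact.of_ladder_linearEquiv_of_exact
      (tensorEquivHomDual_comp_rTensor f N) (e₃ := LinearEquiv.refl R (M ⊗[R] N)) ?_
      (rTensor_exact N hfg hg)
    ext x n
    simp
  · exact (LinearMap.rTensor_surjective N hg).comp (LinearEquiv.surjective _)

end TensorPresentation

section Depth

open IsLocalRing TensorProduct

variable {R : Type u} [CommRing R] [IsLocalRing R]

theorem nontrivial_residueField_tensorProduct (M : Type u) [AddCommGroup M] [Module R M]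
    [Module.Finite R M] [Nontrivial M] : Nontrivial (ResidueField R ⊗[R] M) := by
  by_contra h
  rw [not_nontrivial_iff_subsingleton] at h
  exact bot_ne_top (map_tensorProduct_mk_eq_top (N := (⊥ : Submodule R M)).1
    (Subsingleton.elim _ _))

theorem nontrivial_tensorProduct_of_isLocalRing (M N : Type u) [AddCommGroup M] [Module R M]
    [Module.Finite R M] [Nontrivial M] [AddCommGroup N] [Module R N] [Module.Finite R N]
    [Nontrivial N] : Nontrivial (M ⊗[R] N) := by
  have := nontrivial_residueField_tensorProduct (R := R) M
  have := nontrivial_residueField_tensorProduct (R := R) N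
  have := (AlgebraTensorModule.distribBaseChange R (ResidueField R) M N).toEquiv.nontrivial
  by_contra h
  rw [not_nontrivial_iff_subsingleton] at h
  exact not_subsingleton (ResidueField R ⊗[R] (M ⊗[R] N)) inferInstance

theorem support_residueField : Module.support R (ResidueField R) =
    PrimeSpectrum.zeroLocus (maximalIdeal R : Set R) := by
  rw [Module.support_eq_zeroLocus, ← (maximalIdeal.isMaximal R).eq_of_le
    (mt Module.annihilator_eq_top_iff.1 (not_subsingleton _))
    (maximalIdeal_le_annihilator_residueField R)]

/-- The length of a regular sequence on a finite module is at most the dimension of the ring. -/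
theorem length_le_of_isRegular [IsNoetherianRing R] {d : ℕ} (hdim : ringKrullDim R = d)
    (M : Type u) [AddCommGroup M] [Module R M] [Module.Finite R M] {rs : List R}
    (hreg : RingTheory.Sequence.IsRegular M rs) : rs.length ≤ d := by
  have : Nontrivial (M ⧸ Ideal.ofList rs • (⊤ : Submodule R M)) :=
    Submodule.Quotient.nontrivial_iff.2 hreg.top_ne_smul.symm
  have hle := (Module.supportDim_add_length_eq_supportDim_of_isRegular (M := M) rs hreg).trans_le
    (Module.supportDim_le_ringKrullDim R M)
  have : Nonempty (Module.support R (M ⧸ Ideal.ofList rs • (⊤ : Submodule R M))) :=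
    (Module.nonempty_support_iff.2 ‹_›).to_subtype
  have h0 : (0 : WithBot ℕ∞) ≤ Module.supportDim R (M ⧸ Ideal.ofList rs • (⊤ : Submodule R M)) :=
    Order.krullDim_nonneg
  rw [hdim] at hle
  have := (add_le_add_left h0 _).trans hle
  rw [zero_add] at this
  exact_mod_cast this

/-- The depth of a nonzero finite module is at most the dimension of the ring. -/
theorem not_extVanishesBelow_residueField [IsNoetherianRing R] {d : ℕ} (hdim : ringKrullDim R = d)
    (M : Type u) [AddCommGroup M] [Module R M] [Module.Finite R M] [Nontrivial M] :
    ¬ ExtVanishesBelow R (ResidueField R) M (d + 1) := by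
  intro h
  have hlt : maximalIdeal R • (⊤ : Submodule R M) < ⊤ :=
    lt_top_iff_ne_top.2 (Submodule.top_ne_ideal_smul_of_le_jacobson_annihilator
      (maximalIdeal_le_jacobson _)).symm
  have : Module.Finite R (ModuleCat.of R (ResidueField R)) :=
    inferInstanceAs (Module.Finite R (ResidueField R))
  obtain ⟨rs, hlen, -, hreg⟩ := ModuleCat.exists_isRegular_of_exists_subsingleton_ext
    (maximalIdeal R) (d + 1) (ModuleCat.of R M) hlt (ModuleCat.of R (ResidueField R))
    support_residueField h
  have := length_le_of_isRegular hdim M hreg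
  lia

theorem natCast_le_moduleDepth_iff {M : Type u} [AddCommGroup M] [Module R M] {t : ℕ} :
    (t : ℕ∞) ≤ moduleDepth R M ↔ ExtVanishesBelow R (ResidueField R) M t := by
  simp only [moduleDepth, le_sInf_iff, Set.mem_ofPred_eq, forall_exists_index, and_imp,
    ExtVanishesBelow, ← subsingleton_extModule_iff]
  refine ⟨fun h i hi => ?_, ?_⟩
  · by_contra hn
    rw [not_subsingleton_iff_nontrivial] at hn
    exact absurd (h _ i rfl hn) (by simpa using hi)
  · rintro h _ n rfl hn
    by_contra hlt
    rw [not_le, Nat.cast_lt] at hlt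
    exact not_subsingleton _ (h n hlt)

theorem moduleDepth_eq_natCast_iff {M : Type u} [AddCommGroup M] [Module R M] {t : ℕ} :
    moduleDepth R M = t ↔ ExtVanishesBelow R (ResidueField R) M t ∧
      ¬ ExtVanishesBelow R (ResidueField R) M (t + 1) := by
  rw [← natCast_le_moduleDepth_iff, ← natCast_le_moduleDepth_iff, not_le, Nat.cast_add,
    Nat.cast_one, ENat.lt_natCast_add_one_iff, and_comm]
  exact ⟨fun h => ⟨h.le, h.ge⟩, fun h => le_antisymm h.1 h.2⟩

end Depth

section LinearMap

variable {R : Type u} [CommRing R] {K N T : Type u}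
  [AddCommGroup K] [Module R K] [AddCommGroup N] [Module R N] [AddCommGroup T] [Module R T]

/-- If `Ext^i(T, N) = 0` for `1 ≤ i ≤ t` and `Ext^i(K, N) = 0` for `i < t`, then
`Ext^i(K, Hom(T, N)) = 0` for `i < t`. -/
theorem ExtVanishesBelow.linearMap_of_ext [IsNoetherianRing R] [Module.Finite R T] {t : ℕ}
    (hT : ∀ i, 1 ≤ i → i ≤ t →
      Subsingleton (Abelian.Ext (ModuleCat.of R T) (ModuleCat.of R N) i))
    (hN : ExtVanishesBelow R K N t) : ExtVanishesBelow R K (T →ₗ[R] N) t := by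
  cases t with
  | zero => exact fun i hi => absurd hi (Nat.not_lt_zero i)
  | succ t =>
    obtain ⟨m, p, hp⟩ := Module.Finite.exists_fin' R T
    obtain ⟨n, φ, hφp⟩ := exists_free_cover_ker p
    have hD := ExtVanishesBelow.of_presentation hφp hp (exact_lcomp_mkQ N φ)
      (Submodule.mkQ_surjective _) hT hN
    refine .of_exact (f := LinearMap.lcomp R N p) (g := (LinearMap.lcomp R N φ).rangeRestrict)
      (LinearMap.lcomp_injective_of_surjective p hp) ?_ (LinearMap.surjective_rangeRestrict _)
      hN.linearMap ((ExtVanishesBelow.of_exact (Submodule.injective_subtype _)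
        (LinearMap.exact_subtype_mkQ _) (Submodule.mkQ_surjective _) hN.linearMap
        (hD.mono t.le_succ)).mono t.le_succ)
    rw [LinearMap.exact_iff, LinearMap.ker_rangeRestrict, ← LinearMap.exact_iff]
    exact LinearMap.exact_lcomp_of_exact_of_surjective _ hφp hp

end LinearMap

section TotallyReflexive

variable {R : Type u} [CommRing R] {M : Type u} [AddCommGroup M] [Module R M]

theorem IsTotallyReflexive.extVanishesBelow [IsNoetherianRing R] [Module.Finite R M]
    (hM : IsTotallyReflexive R M) {K : Type u} [AddCommGroup K] [Module R K] {t : ℕ}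
    (hR : ExtVanishesBelow R K R t) : ExtVanishesBelow R K M t :=
  .congr (.ofBijective _ hM.1)
    (.linearMap_of_ext (fun i hi _ => (subsingleton_extModule_iff R _ R i).1 (hM.2.2 i hi)) hR)

/-- The depth of a totally reflexive module over a Cohen-Macaulay local ring is maximal. -/
theorem IsTotallyReflexive.moduleDepth_eq [IsNoetherianRing R] [IsLocalRing R]
    [Module.Finite R M] [Nontrivial M] {d : ℕ} (hdim : ringKrullDim R = d)
    (hCM : moduleDepth R R = (d : ℕ∞)) (hM : IsTotallyReflexive R M) :
    moduleDepth R M = d :=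
  moduleDepth_eq_natCast_iff.2 ⟨hM.extVanishesBelow (natCast_le_moduleDepth_iff.1 hCM.ge),
    not_extVanishesBelow_residueField hdim M⟩

/-- The transpose map of a presentation of a nonzero totally reflexive module has a nonzero
kernel. -/
theorem IsTotallyReflexive.not_injective_dualMap [Nontrivial M] {F₀ F₁ : Type u}
    [AddCommGroup F₀] [Module R F₀] [AddCommGroup F₁] [Module R F₁] {f : F₁ →ₗ[R] F₀}
    {g : F₀ →ₗ[R] M} (hM : IsTotallyReflexive R M) (hg : Function.Surjective g)
    (hfg : Function.Exact f g) : ¬ Function.Injective f.dualMap := by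
  intro hinj
  obtain ⟨x, hx⟩ := exists_ne (0 : M)
  refine hx (hM.1.1 (LinearMap.ext fun ξ => ?_))
  have h : g.dualMap ξ = 0 := hinj <| by
    ext y
    simp [hfg.apply_apply_eq_zero y]
  rw [LinearMap.dualMap_injective_of_surjective hg (h.trans (map_zero _).symm)]
  simp

end TotallyReflexive

/-- **Theorem 4.2.** Let `R` be a Cohen-Macaulay noetherian local ring of Krull dimension `d`,
and `M`, `N` nonzero finitely generated `R`-modules with `M` totally reflexive.  Given a finite
free presentation `F₁ → F₀ → M → 0` with transpose `T = coker (Hom(F₀,R) → Hom(F₁,R))`,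
if `Ext^j_R(T, N) = 0` for `1 ≤ j ≤ d + 1`, then
`depth(M ⊗ N) + depth R = depth M + depth N`. -/
theorem depth_formula_of_totallyReflexive
    (R : Type u) [CommRing R] [IsNoetherianRing R] [IsLocalRing R]
    (d : ℕ) (hdim : ringKrullDim R = d) (hCM : moduleDepth R R = (d : ℕ∞))
    (M N : Type u) [AddCommGroup M] [Module R M] [Module.Finite R M] [Nontrivial M]
    [AddCommGroup N] [Module R N] [Module.Finite R N] [Nontrivial N]
    (hM : IsTotallyReflexive R M)
    (F₀ F₁ : Type u)
    [AddCommGroup F₀] [Module R F₀] [Module.Free R F₀] [Module.Finite R F₀]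
    [AddCommGroup F₁] [Module R F₁] [Module.Free R F₁] [Module.Finite R F₁]
    (f : F₁ →ₗ[R] F₀) (g : F₀ →ₗ[R] M)
    (hg : Function.Surjective g) (hfg : LinearMap.range f = LinearMap.ker g)
    (hExt : ∀ j : ℕ, 1 ≤ j → j ≤ d + 1 →
      Subsingleton (extModule R
        (Module.Dual R F₁ ⧸ LinearMap.range (LinearMap.dualMap f)) N j)) :
    moduleDepth R (TensorProduct R M N) + moduleDepth R R =
      moduleDepth R M + moduleDepth R N := by
  have hexact : Function.Exact f g := LinearMap.exact_iff.2 hfg.symm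
  have hT i (hi : 1 ≤ i) (hid : i ≤ d + 1) := (subsingleton_extModule_iff R _ N i).1 (hExt i hi hid)
  have hφp : Function.Exact f.dualMap (LinearMap.range f.dualMap).mkQ :=
    LinearMap.exact_map_mkQ_range _
  have hp := Submodule.mkQ_surjective (LinearMap.range f.dualMap)
  obtain ⟨q, hq, hqs⟩ := exists_tensor_presentation hg hexact N
  have hle : moduleDepth R N ≤ d := by
    rw [← ENat.lt_natCast_add_one_iff, ← not_le]
    exact_mod_cast mt natCast_le_moduleDepth_iff.1 (not_extVanishesBelow_residueField hdim N)
  obtain ⟨t, ht⟩ := ENat.ne_top_iff_exists.1 (ne_top_of_le_ne_top (ENat.natCast_ne_top d) hle)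
  rw [← ht, Nat.cast_le] at hle
  obtain ⟨hN, hN'⟩ := moduleDepth_eq_natCast_iff.1 ht.symm
  suffices moduleDepth R (TensorProduct R M N) = t by
    rw [this, hCM, hM.moduleDepth_eq hdim hCM, ← ht, add_comm]
  refine moduleDepth_eq_natCast_iff.2 ⟨.of_presentation hφp hp hq hqs
    (fun i hi hit => hT i hi (by lia)) hN, fun h => ?_⟩
  obtain rfl | hlt := hle.eq_or_lt
  · have := nontrivial_tensorProduct_of_isLocalRing (R := R) M N
    exact not_extVanishesBelow_residueField hdim _ h
  · have := h t t.lt_succ_self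
    have := subsingleton_ext_of_presentation hφp hp (hM.not_injective_dualMap hg hexact) hq hqs
      (fun i hi hit => hT i hi (by lia)) hN
    refine hN' fun i hi => ?_
    obtain hi | rfl := Nat.lt_succ_iff_lt_or_eq.1 hi
    · exact hN i hi
    · assumption
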